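/- arXiv:1201.0264 — 5 statements merged into one kernel-verified Lean document; each statement's English description precedes it below -/
import Mathlib

section
/- Let λ > 0, ξ ≥ 0 with ξ² ≠ 2λ, and define ξ̄(ξ,τ) = √(2λ)·coth(√(2λ)·τ) − 2λ/(sinh²(√(2λ)·τ)·(ξ + √(2λ)·coth(√(2λ)·τ))) and φ(l,τ) = ((ξ̄(ξ,τ)² − 2λ)/(ξ² − 2λ))·exp(−l·ξ̄(ξ,τ)) for l ≥ 0, τ > 0. Then φ solves the two-dimensional CDT Feynman–Kac equation: for all l > 0 and τ > 0, ∂φ/∂τ (l,τ) = 2·∂φ/∂l (l,τ) + l·∂²φ/∂l² (l,τ) − 2λ·l·φ(l,τ), and moreover for every fixed l ≥ 0, φ(l,τ) → e^{−ξl} as τ → 0⁺. -/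
open Real Filter Set

/-- The solution of the Riccati equation `x' = s² − x²` with `x(0) = ξ`. -/
noncomputable def riccatiSol (s ξ τ : ℝ) : ℝ :=
  s * (ξ * cosh (s * τ) + s * sinh (s * τ)) / (ξ * sinh (s * τ) + s * cosh (s * τ))

lemma riccatiSol_denom_pos {s ξ τ : ℝ} (hs : 0 < s) (hξ : 0 ≤ ξ) (hτ : 0 ≤ τ) :
    0 < ξ * sinh (s * τ) + s * cosh (s * τ) := by
  have hsinh : 0 ≤ sinh (s * τ) := sinh_nonneg_iff.2 (by positivity)
  have hcosh := cosh_pos (s * τ)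
  positivity

lemma coth_form_eq_riccatiSol {s ξ τ : ℝ} (hs : 0 < s) (hξ : 0 ≤ ξ) (hτ : 0 < τ) :
    s * (cosh (s * τ) / sinh (s * τ)) -
      s ^ 2 / (sinh (s * τ) ^ 2 * (ξ + s * (cosh (s * τ) / sinh (s * τ)))) =
      riccatiSol s ξ τ := by
  have hsinh : sinh (s * τ) ≠ 0 := (sinh_pos_iff.2 (by positivity)).ne'
  have hD := (riccatiSol_denom_pos hs hξ hτ.le).ne'
  have hprod : sinh (s * τ) ^ 2 * (ξ + s * (cosh (s * τ) / sinh (s * τ))) =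
      sinh (s * τ) * (ξ * sinh (s * τ) + s * cosh (s * τ)) := by
    field_simp
  rw [hprod, riccatiSol, mul_div_assoc', div_sub_div _ _ hsinh (mul_ne_zero hsinh hD),
    div_eq_div_iff (mul_ne_zero hsinh (mul_ne_zero hsinh hD)) hD]
  linear_combination (s ^ 2 * sinh (s * τ) * (ξ * sinh (s * τ) + s * cosh (s * τ))) *
    cosh_sq (s * τ)

lemma hasDerivAt_riccatiSol {s ξ τ : ℝ} (hs : 0 < s) (hξ : 0 ≤ ξ) (hτ : 0 ≤ τ) :
    HasDerivAt (riccatiSol s ξ) (s ^ 2 - riccatiSol s ξ τ ^ 2) τ := by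
  have hD := (riccatiSol_denom_pos hs hξ hτ).ne'
  have hlin : HasDerivAt (fun t : ℝ => s * t) s τ := by
    simpa using (hasDerivAt_id τ).const_mul s
  have hnum := ((hlin.cosh.const_mul ξ).add (hlin.sinh.const_mul s)).const_mul s
  have hden := (hlin.sinh.const_mul ξ).add (hlin.cosh.const_mul s)
  refine (hnum.div hden hD).congr_deriv ?_
  simp only [riccatiSol, Pi.add_apply]
  field_simp

lemma riccatiSol_zero {s : ℝ} (hs : s ≠ 0) (ξ : ℝ) : riccatiSol s ξ 0 = ξ := by
  simp [riccatiSol, hs]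

lemma hasDerivAt_const_mul_exp_neg_mul (A x l : ℝ) :
    HasDerivAt (fun l' => A * exp (-l' * x)) (A * -x * exp (-l * x)) l := by
  have h : HasDerivAt (fun l' : ℝ => -l' * x) (-x) l := by
    simpa using (hasDerivAt_id l).neg.mul_const x
  exact (h.exp.const_mul A).congr_deriv (by ring)

/-- The explicit function
`φ(l,τ) = ((ξ̄(ξ,τ)² − 2λ)/(ξ² − 2λ))·exp(−l·ξ̄(ξ,τ))`, with
`ξ̄(ξ,τ) = √(2λ)·coth(√(2λ)τ) − 2λ/(sinh²(√(2λ)τ)·(ξ + √(2λ)·coth(√(2λ)τ)))`,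
solves the two-dimensional CDT Feynman–Kac equation
`∂φ/∂τ = 2·∂φ/∂l + l·∂²φ/∂l² − 2λ·l·φ` for `l > 0`, `τ > 0`,
with initial condition `φ(l,τ) → e^{−ξl}` as `τ → 0⁺`. -/
theorem stmt_0 (lam ξ : ℝ) (hlam : 0 < lam) (hξ : 0 ≤ ξ) (hξlam : ξ ^ 2 ≠ 2 * lam)
    (xibar : ℝ → ℝ)
    (hxibar : ∀ τ : ℝ, xibar τ =
      Real.sqrt (2 * lam) *
        (Real.cosh (Real.sqrt (2 * lam) * τ) / Real.sinh (Real.sqrt (2 * lam) * τ)) -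
      2 * lam / ((Real.sinh (Real.sqrt (2 * lam) * τ)) ^ 2 *
        (ξ + Real.sqrt (2 * lam) *
          (Real.cosh (Real.sqrt (2 * lam) * τ) / Real.sinh (Real.sqrt (2 * lam) * τ)))))
    (φ : ℝ → ℝ → ℝ)
    (hφ : ∀ l τ : ℝ, φ l τ =
      ((xibar τ) ^ 2 - 2 * lam) / (ξ ^ 2 - 2 * lam) * Real.exp (-l * xibar τ)) :
    (∀ l : ℝ, 0 < l → ∀ τ : ℝ, 0 < τ →
      deriv (fun τ' => φ l τ') τ =
        2 * deriv (fun l' => φ l' τ) l + l * deriv (deriv (fun l' => φ l' τ)) l -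
          2 * lam * l * φ l τ) ∧
    (∀ l : ℝ, 0 ≤ l →
      Tendsto (fun τ => φ l τ) (nhdsWithin 0 (Ioi 0)) (nhds (Real.exp (-ξ * l)))) := by
  obtain ⟨s, hs, hs2⟩ : ∃ s : ℝ, 0 < s ∧ s ^ 2 = 2 * lam :=
    ⟨√(2 * lam), by positivity, sq_sqrt (by positivity)⟩
  have hsqrt : √(s ^ 2) = s := sqrt_sq hs.le
  simp only [← hs2, hsqrt] at hxibar hφ hξlam ⊢
  have hc : ξ ^ 2 - s ^ 2 ≠ 0 := sub_ne_zero.2 hξlam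
  have hx : ∀ τ, 0 < τ → xibar τ = riccatiSol s ξ τ := fun τ hτ =>
    (hxibar τ).trans (coth_form_eq_riccatiSol hs hξ hτ)
  refine ⟨fun l _ τ hτ => ?_, fun l _ => ?_⟩
  · have hx' : HasDerivAt xibar (s ^ 2 - xibar τ ^ 2) τ := by
      rw [hx τ hτ]
      refine (hasDerivAt_riccatiSol hs hξ hτ.le).congr_of_eventuallyEq ?_
      filter_upwards [lt_mem_nhds hτ] with t ht using hx t ht
    have htime := (((hx'.pow 2).sub_const (s ^ 2)).div_const (ξ ^ 2 - s ^ 2)).mul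
      (hx'.const_mul (-l)).exp
    have hfun : (fun l' => φ l' τ) = fun l' =>
        (xibar τ ^ 2 - s ^ 2) / (ξ ^ 2 - s ^ 2) * exp (-l' * xibar τ) :=
      funext fun l' => hφ l' τ
    have hspace := fun A : ℝ => funext fun l' =>
      (hasDerivAt_const_mul_exp_neg_mul A (xibar τ) l').deriv
    rw [hfun, hspace, hspace, hφ l τ, funext fun t => hφ l t]
    refine (htime.congr_deriv ?_).deriv
    simp only [Pi.pow_apply]
    field_simp
    ring
  · have hcont : ContinuousAt (riccatiSol s ξ) 0 :=
      (hasDerivAt_riccatiSol hs hξ le_rfl).continuousAt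
    have hlim : Tendsto xibar (nhdsWithin 0 (Ioi 0)) (nhds ξ) := by
      have h := hcont.tendsto.mono_left (nhdsWithin_le_nhds (s := Ioi 0))
      rw [riccatiSol_zero hs.ne'] at h
      refine h.congr' ?_
      filter_upwards [self_mem_nhdsWithin] with t ht using (hx t ht).symm
    have h := (((hlim.pow 2).sub_const (s ^ 2)).div_const (ξ ^ 2 - s ^ 2)).mul
      (hlim.const_mul (-l)).rexp
    rw [div_self hc, one_mul, neg_mul, mul_comm l, ← neg_mul] at h
    exact h.congr fun t => (hφ l t).symm
end

section
/- For λ > 0 and ξ ≥ 0 with ξ² ≠ 2λ, let ξ̄ = √(2λ)·coth(√(2λ)) − 2λ/(sinh²(√(2λ))·(ξ + √(2λ)·coth(√(2λ)))). Then (ξ̄² − 2λ)/(ξ² − 2λ) = 2λ/(√(2λ)·cosh(√(2λ)) + ξ·sinh(√(2λ)))². -/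
open Real

/-- On the hyperbola `c² - s² = 1`, the fractional expression `a·c/s - a²/(s²(ξ + a·c/s))`
is the Möbius transform `a(a·s + ξ·c)/(a·c + ξ·s)` of `ξ`. -/
theorem sub_div_eq_moebius {a c s ξ : ℝ} (hcs : c ^ 2 - s ^ 2 = 1) (hs : s ≠ 0)
    (hD : a * c + ξ * s ≠ 0) :
    a * (c / s) - a ^ 2 / (s ^ 2 * (ξ + a * (c / s))) =
      a * (a * s + ξ * c) / (a * c + ξ * s) := by
  have hden : s ^ 2 * (ξ + a * (c / s)) = s * (a * c + ξ * s) := by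
    field_simp
    ring
  rw [hden, mul_div_assoc', div_sub_div _ _ hs (mul_ne_zero hs hD),
    div_eq_div_iff (mul_ne_zero hs (mul_ne_zero hs hD)) hD]
  linear_combination a ^ 2 * s * (a * c + ξ * s) * hcs

/-- For `λ > 0` and `ξ ≥ 0` with `ξ² ≠ 2λ`, setting
`ξ̄ = √(2λ)·coth(√(2λ)) − 2λ/(sinh²(√(2λ))·(ξ + √(2λ)·coth(√(2λ))))`
one has `(ξ̄² − 2λ)/(ξ² − 2λ) = 2λ/(√(2λ)·cosh(√(2λ)) + ξ·sinh(√(2λ)))²`. -/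
theorem stmt_2 (lam ξ : ℝ) (hlam : 0 < lam) (hξ : 0 ≤ ξ) (hξlam : ξ ^ 2 ≠ 2 * lam)
    (xibar : ℝ)
    (hxibar : xibar =
      Real.sqrt (2 * lam) * (Real.cosh (Real.sqrt (2 * lam)) / Real.sinh (Real.sqrt (2 * lam))) -
      2 * lam / ((Real.sinh (Real.sqrt (2 * lam))) ^ 2 *
        (ξ + Real.sqrt (2 * lam) *
          (Real.cosh (Real.sqrt (2 * lam)) / Real.sinh (Real.sqrt (2 * lam)))))) :
    (xibar ^ 2 - 2 * lam) / (ξ ^ 2 - 2 * lam) =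
      2 * lam /
        (Real.sqrt (2 * lam) * Real.cosh (Real.sqrt (2 * lam)) +
          ξ * Real.sinh (Real.sqrt (2 * lam))) ^ 2 := by
  have ha : 0 < √(2 * lam) := Real.sqrt_pos.mpr (by positivity)
  have hsq : √(2 * lam) ^ 2 = 2 * lam := Real.sq_sqrt (by positivity)
  have hs : 0 < sinh √(2 * lam) := Real.sinh_pos_iff.mpr ha
  have hcs := Real.cosh_sq_sub_sinh_sq √(2 * lam)
  have hc := Real.cosh_pos √(2 * lam)
  generalize √(2 * lam) = a at *
  rw [← hsq] at hxibar hξlam ⊢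
  have hD : a * cosh a + ξ * sinh a ≠ 0 := by positivity
  rw [hxibar, sub_div_eq_moebius hcs hs.ne' hD,
    div_eq_div_iff (sub_ne_zero.mpr hξlam) (pow_ne_zero 2 hD), div_pow, sub_mul,
    div_mul_cancel₀ _ (pow_ne_zero 2 hD)]
  linear_combination a ^ 2 * (ξ ^ 2 - a ^ 2) * hcs
end

section
/- For every λ ≥ 0, ∫₀^∞ (1 − e^{−λx}) · ρ(x) dx = 2·log cosh(√(2λ)), where ρ(x) = (2/x)·Σ_{n=1}^∞ exp(−π²(n − 1/2)²·x/2) for x > 0. Consequently 1/cosh²(√(2λ)) = exp(−∫₀^∞ (1 − e^{−λx})ρ(x) dx), i.e. the distribution with Laplace transform 1/cosh²(√(2λ)) is infinitely divisible with Lévy density ρ and drift c = 0. -/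
open Real MeasureTheory Set

open Filter Topology in
/-- Euler's infinite product for the hyperbolic sine. -/
theorem tendsto_euler_sinh_prod (s : ℝ) :
    Tendsto (fun n : ℕ => s * ∏ j ∈ Finset.range n, (1 + s ^ 2 / (π ^ 2 * ((j : ℝ) + 1) ^ 2)))
      atTop (𝓝 (sinh s)) := by
  have hpi : (π : ℂ) ≠ 0 := Complex.ofReal_ne_zero.2 pi_ne_zero
  have h := (Complex.continuous_im.tendsto _).comp
    (Complex.tendsto_euler_sin_prod ((s : ℂ) / π * Complex.I))
  have hsin : Complex.sin (π * ((s : ℂ) / π * Complex.I)) = (sinh s : ℂ) * Complex.I := by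
    rw [← mul_assoc, mul_div_cancel₀ _ hpi, Complex.sin_mul_I, Complex.ofReal_sinh]
  rw [hsin, Complex.im_ofReal_mul, Complex.I_im, mul_one] at h
  refine h.congr fun n => ?_
  have hfac : ∀ j : ℕ, (1 : ℂ) - ((s : ℂ) / π * Complex.I) ^ 2 / ((j : ℂ) + 1) ^ 2 =
      ((1 + s ^ 2 / (π ^ 2 * ((j : ℝ) + 1) ^ 2) : ℝ) : ℂ) := by
    intro j
    push_cast
    rw [mul_pow, Complex.I_sq, div_pow, ← div_div]
    ring
  simp only [Function.comp_apply, hfac]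
  rw [← mul_assoc, mul_div_cancel₀ _ hpi, ← Complex.ofReal_prod, mul_right_comm,
    ← Complex.ofReal_mul, Complex.im_ofReal_mul, Complex.I_im, mul_one]

open Filter Topology in
/-- Euler's infinite product for the hyperbolic cosine. -/
theorem tendsto_euler_cosh_prod (s : ℝ) :
    Tendsto (fun n : ℕ => ∏ j ∈ Finset.range n, (1 + s ^ 2 / (π ^ 2 * ((j : ℝ) + 1 / 2) ^ 2)))
      atTop (𝓝 (cosh s)) := by
  rcases eq_or_ne s 0 with rfl | hs
  · simp
  have hpos : ∀ j : ℕ, 0 < 1 + s ^ 2 / (π ^ 2 * ((j : ℝ) + 1) ^ 2) := fun j => by positivity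
  have hsplit : ∀ n : ℕ,
      ∏ j ∈ Finset.range (2 * n), (1 + (2 * s) ^ 2 / (π ^ 2 * ((j : ℝ) + 1) ^ 2)) =
      (∏ j ∈ Finset.range n, (1 + s ^ 2 / (π ^ 2 * ((j : ℝ) + 1) ^ 2))) *
        ∏ j ∈ Finset.range n, (1 + s ^ 2 / (π ^ 2 * ((j : ℝ) + 1 / 2) ^ 2)) := by
    intro n
    induction n with
    | zero => simp
    | succ n ih =>
      rw [mul_add_one, Finset.prod_range_succ, Finset.prod_range_succ, ih,
        Finset.prod_range_succ, Finset.prod_range_succ]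
      have h1 : (2 * s) ^ 2 / (π ^ 2 * (((2 * n : ℕ) : ℝ) + 1) ^ 2) =
          s ^ 2 / (π ^ 2 * ((n : ℝ) + 1 / 2) ^ 2) := by
        push_cast
        field_simp
      have h2 : (2 * s) ^ 2 / (π ^ 2 * (((2 * n + 1 : ℕ) : ℝ) + 1) ^ 2) =
          s ^ 2 / (π ^ 2 * ((n : ℝ) + 1) ^ 2) := by
        push_cast
        rw [show 2 * (n : ℝ) + 1 + 1 = 2 * (n + 1) by ring]
        field_simp
      rw [h1, h2]
      ring
  have hsinh : sinh s ≠ 0 := by simpa using hs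
  have hnum := (tendsto_euler_sinh_prod (2 * s)).comp
    (tendsto_id.const_mul_atTop' (zero_lt_two : (0 : ℕ) < 2))
  have h := hnum.div ((tendsto_euler_sinh_prod s).const_mul 2) (by simpa using hs)
  rw [sinh_two_mul, mul_assoc 2, mul_div_mul_left _ _ two_ne_zero,
    mul_div_cancel_left₀ _ hsinh] at h
  refine h.congr fun n => ?_
  have hne : ∏ j ∈ Finset.range n, (1 + s ^ 2 / (π ^ 2 * ((j : ℝ) + 1) ^ 2)) ≠ 0 :=
    Finset.prod_ne_zero_iff.2 fun j _ => (hpos j).ne'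
  simp only [Pi.div_apply, Function.comp_apply, id, hsplit]
  field_simp

/-- The series of logarithms obtained from Euler's product for the hyperbolic cosine. -/
theorem hasSum_log_cosh (s : ℝ) :
    HasSum (fun n : ℕ => log (1 + s ^ 2 / (π ^ 2 * ((n : ℝ) + 1 / 2) ^ 2))) (log (cosh s)) := by
  have hpos : ∀ j : ℕ, 0 ≤ s ^ 2 / (π ^ 2 * ((j : ℝ) + 1 / 2) ^ 2) := fun j => by positivity
  rw [hasSum_iff_tendsto_nat_of_nonneg fun j => log_nonneg (by linarith [hpos j])]
  refine ((tendsto_euler_cosh_prod s).log (cosh_pos s).ne').congr fun n => ?_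
  exact log_prod fun j _ => by linarith [hpos j]

theorem integrableOn_inv_mul_exp_sub_exp {a b : ℝ} (ha : 0 < a) (hab : a ≤ b) :
    IntegrableOn (fun x : ℝ => x⁻¹ * (exp (-(a * x)) - exp (-(b * x)))) (Ioi 0) := by
  have hdom : IntegrableOn (fun x : ℝ => (b - a) * exp (-a * x)) (Ioi 0) :=
    (exp_neg_integrableOn_Ioi 0 ha).const_mul _
  refine Integrable.mono' hdom (by fun_prop) ?_
  filter_upwards [ae_restrict_mem measurableSet_Ioi] with x hx
  have hx : 0 < x := hx
  have hexp : exp (-(b * x)) = exp (-(a * x)) * exp (-((b - a) * x)) := by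
    rw [← exp_add]
    ring_nf
  have hle : exp (-(b * x)) ≤ exp (-(a * x)) := exp_le_exp.2 (by nlinarith)
  rw [Real.norm_of_nonneg (mul_nonneg (inv_nonneg.2 hx.le) (sub_nonneg.2 hle)),
    inv_mul_le_iff₀ hx, hexp, neg_mul]
  have hlin := mul_le_mul_of_nonneg_left (add_one_le_exp (-((b - a) * x))) (exp_pos (-(a * x))).le
  linarith

/-- Frullani's integral for the exponential function. -/
theorem integral_inv_mul_exp_sub_exp {a b : ℝ} (ha : 0 < a) (hab : a ≤ b) :
    ∫ x in Ioi (0 : ℝ), x⁻¹ * (exp (-(a * x)) - exp (-(b * x))) = log (b / a) := by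
  have hcont : Continuous fun x : ℝ => exp (-x) := by fun_prop
  have h := Frullani.integral_Ioi_eq (f := fun x : ℝ => exp (-x)) (L := 1) (R := 0)
    (hcont.locallyIntegrable.locallyIntegrableOn _) ha (ha.trans_le hab)
    (by simpa using (hcont.tendsto 0).mono_left nhdsWithin_le_nhds)
    tendsto_exp_neg_atTop_nhds_zero (integrableOn_inv_mul_exp_sub_exp ha hab)
  simpa using h

/-- With the Lévy density
`ρ(x) = (2/x)·Σ_{n=1}^∞ exp(−π²(n − 1/2)²x/2)` for `x > 0`
(the sum over `n ≥ 1` is indexed here by `n : ℕ` via `n ↦ n + 1`), one has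
`∫₀^∞ (1 − e^{−λx})·ρ(x) dx = 2·log cosh(√(2λ))` for all `λ ≥ 0`, and consequently
`1/cosh²(√(2λ)) = exp(−∫₀^∞ (1 − e^{−λx})ρ(x) dx)`: the distribution with Laplace
transform `1/cosh²(√(2λ))` is infinitely divisible with Lévy density `ρ` and drift 0. -/
theorem stmt_7 (ρ : ℝ → ℝ)
    (hρ : ∀ x : ℝ, 0 < x → ρ x =
      (2 / x) * ∑' n : ℕ, Real.exp (-Real.pi ^ 2 * (((n : ℝ) + 1) - 1 / 2) ^ 2 * x / 2)) :
    ∀ lam : ℝ, 0 ≤ lam →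
      (∫ x in Ioi (0 : ℝ), (1 - Real.exp (-lam * x)) * ρ x =
        2 * Real.log (Real.cosh (Real.sqrt (2 * lam)))) ∧
      1 / (Real.cosh (Real.sqrt (2 * lam))) ^ 2 =
        Real.exp (-∫ x in Ioi (0 : ℝ), (1 - Real.exp (-lam * x)) * ρ x) := by
  intro lam hlam
  have hmain : ∫ x in Ioi (0 : ℝ), (1 - Real.exp (-lam * x)) * ρ x =
      2 * Real.log (Real.cosh (Real.sqrt (2 * lam))) := by
    set a : ℕ → ℝ := fun n => π ^ 2 * ((n : ℝ) + 1 / 2) ^ 2 / 2 with ha_def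
    have ha : ∀ n, 0 < a n := fun n => by positivity
    have hab : ∀ n, a n ≤ a n + lam := fun n => by linarith
    set F : ℕ → ℝ → ℝ := fun n x =>
      x⁻¹ * (Real.exp (-(a n * x)) - Real.exp (-((a n + lam) * x))) with hF_def
    have hsum : HasSum (fun n => ∫ x in Ioi (0 : ℝ), F n x)
        (Real.log (Real.cosh (Real.sqrt (2 * lam)))) := by
      convert hasSum_log_cosh (Real.sqrt (2 * lam)) using 2 with n
      rw [integral_inv_mul_exp_sub_exp (ha n) (hab n), Real.sq_sqrt (by positivity),
        add_div, div_self (ha n).ne']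
      congr 2
      simp only [ha_def]
      field_simp
    have hnorm : ∀ n, ∫ x in Ioi (0 : ℝ), ‖F n x‖ = ∫ x in Ioi (0 : ℝ), F n x := by
      refine fun n => setIntegral_congr_fun measurableSet_Ioi fun x hx => ?_
      have hx : 0 < x := hx
      refine Real.norm_of_nonneg (mul_nonneg (inv_nonneg.2 hx.le) (sub_nonneg.2 ?_))
      exact Real.exp_le_exp.2 (by nlinarith)
    have hint := hasSum_integral_of_summable_integral_norm (F := F)
      (fun n => integrableOn_inv_mul_exp_sub_exp (ha n) (hab n)) (by
        simpa only [hnorm] using hsum.summable)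
    rw [hsum.unique hint, ← integral_const_mul]
    refine setIntegral_congr_fun measurableSet_Ioi fun x hx => ?_
    simp only [hρ x hx]
    rw [← mul_assoc, ← tsum_mul_left, ← tsum_mul_left]
    refine tsum_congr fun n => ?_
    have hexp : Real.exp (-((a n + lam) * x)) = Real.exp (-lam * x) * Real.exp (-(a n * x)) := by
      rw [← Real.exp_add]
      ring_nf
    have hterm : -Real.pi ^ 2 * (((n : ℝ) + 1) - 1 / 2) ^ 2 * x / 2 = -(a n * x) := by
      simp only [ha_def]
      ring
    simp only [hF_def]
    rw [hexp, hterm]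
    ring
  refine ⟨hmain, ?_⟩
  rw [hmain, Real.exp_neg, two_mul (Real.log _), Real.exp_add, Real.exp_log (Real.cosh_pos _), one_div, sq]
end

section
/- Let p be a probability distribution on the non-negative integers with Σ_{n≥0} p(n) = 1. For a finite family tree τ of height at most h, define W_h(τ) = ∏_{v ∈ τ, |v| ≤ h−1} p(c_v(τ)). Then for every h ≥ 0 and every finite family tree τ_h of height at most h: Σ W_{h+1}(τ_{h+1}) = W_h(τ_h), where the sum runs over all finite family trees τ_{h+1} of height at most h+1 with r_h(τ_{h+1}) = τ_h. -/
/-- A *family tree*: a set of finite sequences of positive integers containing the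
empty sequence (the root), closed under taking predecessors, and such that for
every vertex `u` there is `k ≥ 0` with `u ++ [j]` in the tree iff `1 ≤ j ≤ k`. -/
structure FamilyTree where
  carrier : Set (List ℕ+)
  nil_mem : [] ∈ carrier
  pred_mem : ∀ (u : List ℕ+) (j : ℕ+), u ++ [j] ∈ carrier → u ∈ carrier
  children_initial : ∀ u ∈ carrier, ∃ k : ℕ, ∀ j : ℕ+, (u ++ [j] ∈ carrier ↔ (j : ℕ) ≤ k)

namespace FamilyTree

/-- `c_v(τ)`: the number of successors (children) of the vertex `v` in `τ`. -/
noncomputable def childCount (τ : FamilyTree) (v : List ℕ+) : ℕ :=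
  Set.ncard {j : ℕ+ | v ++ [j] ∈ τ.carrier}

/-- The carrier of the restriction `r_h(τ)` of `τ` to heights `≤ h`. -/
def restrictSet (τ : FamilyTree) (h : ℕ) : Set (List ℕ+) :=
  {u ∈ τ.carrier | u.length ≤ h}

/-- `Z_h(τ)`: the number of vertices of `τ` of height exactly `h`. -/
noncomputable def Z (τ : FamilyTree) (h : ℕ) : ℕ :=
  Set.ncard {u ∈ τ.carrier | u.length = h}

/-- The Galton–Watson cylinder weight `W_h(τ) = ∏_{v ∈ τ, |v| ≤ h−1} p(c_v(τ))`. -/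
noncomputable def W (p : ℕ → ℝ) (h : ℕ) (τ : FamilyTree) : ℝ :=
  ∏ᶠ v ∈ {u ∈ τ.carrier | u.length + 1 ≤ h}, p (τ.childCount v)

end FamilyTree

open FamilyTree

/-- The product of finitely many copies of a nonnegative summable family sums, over the tuples of
indices, to the corresponding power of its sum. -/
theorem hasSum_fin_pi_prod {κ : Type*} {g : κ → ℝ} {a : ℝ} (hg : ∀ k, 0 ≤ g k)
    (ha : HasSum g a) (n : ℕ) : HasSum (fun f : Fin n → κ => ∏ i, g (f i)) (a ^ n) := by
  induction n with
  | zero => simp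
  | succ n ih =>
    rw [← (Fin.consEquiv fun _ => κ).hasSum_iff, pow_succ']
    have hsummable : Summable fun x : κ × (Fin n → κ) => g x.1 * ∏ i, g (x.2 i) :=
      Summable.mul_of_nonneg (f := g) (g := fun f : Fin n → κ => ∏ i, g (f i)) ha.summable
        ih.summable (Pi.le_def.2 hg) (Pi.le_def.2 fun f => Finset.prod_nonneg fun i _ => hg (f i))
    have hmul := ha.mul ih hsummable
    refine hmul.congr_fun ?_
    intro x
    simp [Fin.prod_univ_succ, Fin.consEquiv]

theorem hasSum_pi_prod {ι κ : Type*} [Fintype ι] {g : κ → ℝ} {a : ℝ} (hg : ∀ k, 0 ≤ g k)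
    (ha : HasSum g a) : HasSum (fun f : ι → κ => ∏ i, g (f i)) (a ^ Fintype.card ι) := by
  rw [← (Equiv.arrowCongr (Fintype.equivFin ι) (Equiv.refl κ)).symm.hasSum_iff]
  convert hasSum_fin_pi_prod hg ha (Fintype.card ι) using 2 with f
  exact Fintype.prod_equiv (Fintype.equivFin ι) _ _ fun i => by simp [Equiv.arrowCongr]

namespace FamilyTree

@[ext]
theorem ext {τ σ : FamilyTree} (hc : τ.carrier = σ.carrier) : τ = σ := by
  cases τ
  cases σ
  congr

theorem ncard_pnat_le (k : ℕ) : Set.ncard {j : ℕ+ | (j : ℕ) ≤ k} = k := by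
  have himg : (fun j : ℕ+ => (j : ℕ)) '' {j : ℕ+ | (j : ℕ) ≤ k} = Finset.Icc 1 k := by
    ext n
    simp only [Set.mem_image, Set.mem_ofPred_eq, Finset.coe_Icc, Set.mem_Icc]
    constructor
    · rintro ⟨j, hj, rfl⟩
      exact ⟨j.pos, hj⟩
    · rintro ⟨h1, h2⟩
      exact ⟨⟨n, h1⟩, h2, rfl⟩
  rw [← Set.ncard_image_of_injective _ PNat.coe_injective, himg, Set.ncard_coe_finset]
  simp

theorem childCount_eq {τ : FamilyTree} {v : List ℕ+} {k : ℕ}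
    (hk : ∀ j : ℕ+, v ++ [j] ∈ τ.carrier ↔ (j : ℕ) ≤ k) : τ.childCount v = k := by
  simp only [childCount, hk, ncard_pnat_le]

theorem append_mem_iff {τ : FamilyTree} {v : List ℕ+} (hv : v ∈ τ.carrier) (j : ℕ+) :
    v ++ [j] ∈ τ.carrier ↔ (j : ℕ) ≤ τ.childCount v := by
  obtain ⟨k, hk⟩ := τ.children_initial v hv
  rw [childCount_eq hk, hk]

/-- The vertices of `τ` of height exactly `h`. -/
def level (τ : FamilyTree) (h : ℕ) : Set (List ℕ+) :=
  {u ∈ τ.carrier | u.length = h}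

/-- The vertices obtained by attaching `f u` children to every vertex `u` of height `h`. -/
def extendSet (τ : FamilyTree) (h : ℕ) (f : τ.level h → ℕ) : Set (List ℕ+) :=
  {w | w ∈ τ.carrier ∨ ∃ (u : τ.level h) (j : ℕ+), (j : ℕ) ≤ f u ∧ w = u.1 ++ [j]}

theorem append_mem_extendSet {τ : FamilyTree} {h : ℕ} {f : τ.level h → ℕ} {v : List ℕ+}
    {j : ℕ+} : v ++ [j] ∈ τ.extendSet h f ↔
      v ++ [j] ∈ τ.carrier ∨ ∃ hv : v ∈ τ.level h, (j : ℕ) ≤ f ⟨v, hv⟩ := by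
  refine or_congr_right ⟨?_, fun ⟨hv, hj⟩ => ⟨⟨v, hv⟩, j, hj, rfl⟩⟩
  rintro ⟨⟨u, hu⟩, i, hi, he⟩
  obtain ⟨rfl, hij⟩ := List.append_inj' he rfl
  obtain rfl : j = i := by simpa using hij
  exact ⟨hu, hi⟩

theorem append_level_mem_extendSet {τ : FamilyTree} {h : ℕ}
    (hheight : ∀ u ∈ τ.carrier, u.length ≤ h) (f : τ.level h → ℕ) (u : τ.level h) (j : ℕ+) :
    u.1 ++ [j] ∈ τ.extendSet h f ↔ (j : ℕ) ≤ f u := by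
  rw [append_mem_extendSet]
  constructor
  · rintro (hu | ⟨_, hj⟩)
    · have := hheight _ hu
      have := u.2.2
      simp at *
      omega
    · exact hj
  · exact fun hj => Or.inr ⟨u.2, hj⟩

theorem append_mem_extendSet_of_not_mem_level {τ : FamilyTree} {h : ℕ} {f : τ.level h → ℕ}
    {v : List ℕ+} (hv : v ∉ τ.level h) (j : ℕ+) :
    v ++ [j] ∈ τ.extendSet h f ↔ v ++ [j] ∈ τ.carrier := by
  simp [append_mem_extendSet, hv]

/-- The tree obtained from a tree of height at most `h` by attaching `f u` children to every
vertex `u` of height `h`. -/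
def extend (τ : FamilyTree) (h : ℕ) (hheight : ∀ u ∈ τ.carrier, u.length ≤ h)
    (f : τ.level h → ℕ) : FamilyTree where
  carrier := τ.extendSet h f
  nil_mem := Or.inl τ.nil_mem
  pred_mem u j hu := by
    rcases append_mem_extendSet.1 hu with hu | ⟨hv, -⟩
    · exact Or.inl (τ.pred_mem u j hu)
    · exact Or.inl hv.1
  children_initial u _ := by
    by_cases hl : u ∈ τ.level h
    · exact ⟨f ⟨u, hl⟩, append_level_mem_extendSet hheight f ⟨u, hl⟩⟩
    · simp only [append_mem_extendSet_of_not_mem_level hl]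
      by_cases hm : u ∈ τ.carrier
      · exact τ.children_initial u hm
      · exact ⟨0, fun j => iff_of_false (fun hj => hm (τ.pred_mem u j hj)) (by simp)⟩

variable {τ : FamilyTree} {h : ℕ} {hheight : ∀ u ∈ τ.carrier, u.length ≤ h}

theorem childCount_extend (f : τ.level h → ℕ) (u : τ.level h) :
    (τ.extend h hheight f).childCount u = f u :=
  childCount_eq (append_level_mem_extendSet hheight f u)

theorem childCount_extend_of_not_mem_level (f : τ.level h → ℕ) {v : List ℕ+}
    (hv : v ∉ τ.level h) : (τ.extend h hheight f).childCount v = τ.childCount v := by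
  unfold childCount
  congr 1
  ext j
  exact append_mem_extendSet_of_not_mem_level hv j

theorem restrictSet_extend (f : τ.level h → ℕ) :
    (τ.extend h hheight f).restrictSet h = τ.carrier := by
  ext w
  constructor
  · rintro ⟨hw | ⟨u, j, -, rfl⟩, hl⟩
    · exact hw
    · have := u.2.2
      simp at hl
      omega
  · exact fun hw => ⟨Or.inl hw, hheight w hw⟩

theorem length_le_of_mem_extend (f : τ.level h → ℕ) :
    ∀ w ∈ (τ.extend h hheight f).carrier, w.length ≤ h + 1 := by
  rintro w (hw | ⟨u, j, -, rfl⟩)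
  · exact (hheight w hw).trans h.le_succ
  · simp [u.2.2]

theorem finite_level (hfin : τ.carrier.Finite) : (τ.level h).Finite :=
  hfin.subset fun _ hu => hu.1

theorem finite_extend (hfin : τ.carrier.Finite) (f : τ.level h → ℕ) :
    (τ.extend h hheight f).carrier.Finite := by
  have := (finite_level (h := h) hfin).to_subtype
  have hj (k : ℕ) : {j : ℕ+ | (j : ℕ) ≤ k}.Finite :=
    (Set.finite_le_nat k).preimage PNat.coe_injective.injOn
  refine (hfin.union (Set.finite_iUnion fun u : τ.level h =>
    (hj (f u)).image fun j => u.1 ++ [j])).subset ?_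
  rintro w (hw | ⟨u, j, hju, rfl⟩)
  · exact Or.inl hw
  · exact Or.inr (Set.mem_iUnion.2 ⟨u, j, hju, rfl⟩)

theorem extend_injective : Function.Injective (τ.extend h hheight) := fun f g hfg => by
  ext u
  rw [← childCount_extend (hheight := hheight) f u, hfg, childCount_extend]

theorem extend_childCount {σ : FamilyTree} (hσ : ∀ u ∈ σ.carrier, u.length ≤ h + 1)
    (hr : σ.restrictSet h = τ.carrier) :
    τ.extend h hheight (fun u => σ.childCount u) = σ := by
  have hsub : τ.carrier ⊆ σ.carrier := by
    rw [← hr]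
    exact fun w hw => hw.1
  ext w
  constructor
  · rintro (hw | ⟨u, j, hj, rfl⟩)
    · exact hsub hw
    · exact (append_mem_iff (hsub u.2.1) j).2 hj
  · intro hw
    by_cases hl : w.length ≤ h
    · refine Or.inl ?_
      rw [← hr]
      exact ⟨hw, hl⟩
    · have hlen : w.length = h + 1 := by
        have := hσ w hw
        omega
      obtain rfl | ⟨v, j, rfl⟩ := List.eq_nil_or_concat' w
      · simp at hlen
      · have hv := σ.pred_mem v j hw
        have hvl : v.length = h := by simpa using hlen
        have hvτ : v ∈ τ.carrier := by
          rw [← hr]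
          exact ⟨hv, hvl.le⟩
        exact Or.inr ⟨⟨v, hvτ, hvl⟩, j, (append_mem_iff hv j).1 hw, rfl⟩

/-- Extensions of `τ` by one generation correspond to choices of the numbers of children of the
vertices of height `h`. -/
noncomputable def extendEquiv (τ : FamilyTree) (h : ℕ) (hfin : τ.carrier.Finite)
    (hheight : ∀ u ∈ τ.carrier, u.length ≤ h) :
    (τ.level h → ℕ) ≃ {σ : FamilyTree // σ.carrier.Finite ∧
      (∀ u ∈ σ.carrier, u.length ≤ h + 1) ∧ σ.restrictSet h = τ.carrier} :=
  Equiv.ofBijective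
    (fun f => ⟨τ.extend h hheight f, finite_extend hfin f, length_le_of_mem_extend f,
      restrictSet_extend f⟩)
    ⟨fun _ _ hfg => extend_injective (hheight := hheight) (congrArg Subtype.val hfg),
      fun σ => ⟨fun u => σ.1.childCount u, Subtype.ext
        (extend_childCount (hheight := hheight) σ.2.2.1 σ.2.2.2)⟩⟩

theorem W_extend (p : ℕ → ℝ) (hfin : τ.carrier.Finite) [Fintype (τ.level h)]
    (f : τ.level h → ℕ) :
    W p (h + 1) (τ.extend h hheight f) = W p h τ * ∏ u, p (f u) := by
  have hset : {u ∈ (τ.extend h hheight f).carrier | u.length + 1 ≤ h + 1} =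
      {u ∈ τ.carrier | u.length + 1 ≤ h} ∪ τ.level h := by
    have hrestrict := restrictSet_extend (hheight := hheight) f
    ext u
    have hu := Set.ext_iff.1 hrestrict u
    have hl := hheight u
    simp only [restrictSet, level, Set.mem_ofPred_eq, Set.mem_union] at hu ⊢
    rw [Nat.add_le_add_iff_right, hu]
    constructor
    · intro hm
      rcases (hl hm).lt_or_eq with hlt | heq
      · exact Or.inl ⟨hm, hlt⟩
      · exact Or.inr ⟨hm, heq⟩
    · rintro (hm | hm) <;> exact hm.1
  have hdisj : Disjoint {u ∈ τ.carrier | u.length + 1 ≤ h} (τ.level h) := by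
    rw [Set.disjoint_left]
    rintro u ⟨-, hlt⟩ ⟨-, heq⟩
    omega
  unfold W
  rw [hset, finprod_mem_union hdisj (hfin.subset fun _ hu => hu.1) (finite_level hfin)]
  congr 1
  · refine finprod_mem_congr rfl fun v hv => ?_
    rw [childCount_extend_of_not_mem_level f (Set.disjoint_left.1 hdisj hv)]
  · rw [← finprod_set_coe_eq_finprod_mem, finprod_eq_prod_of_fintype]
    simp only [childCount_extend]

end FamilyTree

/-- consistency of the Galton–Watson cylinder weights
`W_h(τ) = ∏_{v ∈ τ, |v| ≤ h−1} p(c_v(τ))`: for every finite family tree `τ_h` of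
height at most `h`, the sum of `W_{h+1}` over all finite family trees `τ_{h+1}` of
height at most `h+1` restricting to `τ_h` equals `W_h(τ_h)`. -/
theorem stmt_12 (p : ℕ → ℝ) (hp_nonneg : ∀ n, 0 ≤ p n)
    (hp_summable : Summable p) (hp_sum : ∑' n, p n = 1)
    (h : ℕ) (τh : FamilyTree) (hfin : τh.carrier.Finite)
    (hheight : ∀ u ∈ τh.carrier, u.length ≤ h) :
    ∑' τ' : {τ' : FamilyTree // τ'.carrier.Finite ∧
        (∀ u ∈ τ'.carrier, u.length ≤ h + 1) ∧ τ'.restrictSet h = τh.carrier},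
      W p (h + 1) τ'.val = W p h τh := by
  have := (finite_level (h := h) hfin).fintype
  rw [← (extendEquiv τh h hfin hheight).tsum_eq]
  have hval (f : τh.level h → ℕ) :
      W p (h + 1) (extendEquiv τh h hfin hheight f).val = W p h τh * ∏ u, p (f u) :=
    W_extend (hheight := hheight) p hfin f
  have hone : HasSum p 1 := hp_sum ▸ hp_summable.hasSum
  simp only [hval, tsum_mul_left, (hasSum_pi_prod hp_nonneg hone).tsum_eq, one_pow, mul_one]
end

section
/- Let c > 0 and let g : ℝ → ℝ be twice continuously differentiable with g″ vanishing outside [0,c]. Let x > 0 and let a ∈ ℝ be such that x + u·a ≥ x(1−u) for all u ∈ [0,1]. Then | ∫₀¹ (1−u)·(g″(x + u·a) − g″(x)) du | ≤ ‖g″‖_∞ · (min(c/x, 1))², where ‖g″‖_∞ = sup_{y∈ℝ}|g″(y)|. Consequently, for any real S, | ∫₀¹ S²·x·(1−u)·(g″(x + u·a) − g″(x)) du | ≤ x·‖g″‖_∞·(min(c/x,1))²·S². -/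
open Real Set intervalIntegral

/-- A function on `[0,1]` vanishing on `(0, 1 - m)` and bounded by `2 * M * (1 - u)` has integral
at most `M * m ^ 2`. -/
theorem abs_integral_le_mul_sq {f : ℝ → ℝ} (hf : Continuous f) {M m : ℝ} (hm : m ∈ Icc (0 : ℝ) 1)
    (hzero : ∀ u ∈ Ioo 0 (1 - m), f u = 0)
    (hbound : ∀ u ∈ Icc (0 : ℝ) 1, |f u| ≤ 2 * M * (1 - u)) :
    |∫ u in (0 : ℝ)..1, f u| ≤ M * m ^ 2 := by
  have hleft : ∫ u in (0 : ℝ)..(1 - m), f u = 0 := by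
    rw [integral_of_le (by linarith [hm.2]), MeasureTheory.integral_Ioc_eq_integral_Ioo]
    exact MeasureTheory.setIntegral_eq_zero_of_forall_eq_zero hzero
  have hright : ∫ u in (1 - m)..1, 2 * M * (1 - u) = M * m ^ 2 := by
    rw [integral_const_mul, integral_sub (by simp) (by simp), integral_const, integral_id,
      smul_eq_mul]
    ring
  rw [← integral_add_adjacent_intervals (b := 1 - m) (hf.intervalIntegrable _ _)
    (hf.intervalIntegrable _ _), hleft, zero_add, ← hright, ← norm_eq_abs]
  have hint : Continuous fun u : ℝ ↦ 2 * M * (1 - u) := by fun_prop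
  refine norm_integral_le_of_norm_le (by linarith [hm.1])
    (Filter.Eventually.of_forall fun u hu ↦ ?_) (hint.intervalIntegrable _ _)
  exact hbound u ⟨by linarith [hm.2, hu.1], hu.2⟩

/-- A continuous function vanishing outside a compact interval has bounded absolute value. -/
theorem bddAbove_range_abs_of_eq_zero_off_Icc {h : ℝ → ℝ} (hh : Continuous h) {a b : ℝ}
    (hsupp : ∀ y ∉ Icc a b, h y = 0) : BddAbove (range fun y ↦ |h y|) := by
  obtain ⟨C, hC⟩ :=
    (HasCompactSupport.intro isCompact_Icc hsupp).exists_bound_of_continuous hh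
  exact ⟨C, by rintro _ ⟨y, rfl⟩; exact hC y⟩

/-- the deterministic Taylor-remainder estimate. If `g` is `C²` with
`g″` vanishing outside `[0,c]`, `x > 0`, and `a` satisfies `x + u·a ≥ x(1−u)` for
all `u ∈ [0,1]`, then
`|∫₀¹(1−u)(g″(x+ua) − g″(x))du| ≤ ‖g″‖_∞·(min(c/x,1))²`, and consequently for any
real `S`, `|∫₀¹ S²x(1−u)(g″(x+ua) − g″(x))du| ≤ x·‖g″‖_∞·(min(c/x,1))²·S²`. -/
theorem stmt_18 (c : ℝ) (hc : 0 < c) (g : ℝ → ℝ) (hg : ContDiff ℝ 2 g)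
    (hsupp : ∀ y : ℝ, y ∉ Icc (0 : ℝ) c → deriv (deriv g) y = 0)
    (x : ℝ) (hx : 0 < x) (a : ℝ)
    (ha : ∀ u ∈ Icc (0 : ℝ) 1, x * (1 - u) ≤ x + u * a) :
    |∫ u in (0 : ℝ)..1, (1 - u) * (deriv (deriv g) (x + u * a) - deriv (deriv g) x)| ≤
      (⨆ y : ℝ, |deriv (deriv g) y|) * min (c / x) 1 ^ 2 ∧
    ∀ S : ℝ,
      |∫ u in (0 : ℝ)..1, S ^ 2 * x * (1 - u) *
          (deriv (deriv g) (x + u * a) - deriv (deriv g) x)| ≤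
        x * (⨆ y : ℝ, |deriv (deriv g) y|) * min (c / x) 1 ^ 2 * S ^ 2 := by
  have hcont : Continuous (deriv (deriv g)) := by
    simpa [iteratedDeriv_succ, iteratedDeriv_zero] using hg.continuous_iteratedDeriv 2 le_rfl
  have hbdd := bddAbove_range_abs_of_eq_zero_off_Icc hcont hsupp
  have hle : ∀ y, |deriv (deriv g) y| ≤ ⨆ y : ℝ, |deriv (deriv g) y| := le_ciSup hbdd
  have main : |∫ u in (0 : ℝ)..1, (1 - u) * (deriv (deriv g) (x + u * a) - deriv (deriv g) x)| ≤
      (⨆ y : ℝ, |deriv (deriv g) y|) * min (c / x) 1 ^ 2 := by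
    refine abs_integral_le_mul_sq (by fun_prop)
      ⟨le_min (by positivity) zero_le_one, min_le_right _ _⟩ (fun u hu ↦ ?_) fun u hu ↦ ?_
    · have hmin : min (c / x) 1 < 1 - u := by linarith [hu.2]
      have hcu : c < x * (1 - u) := by
        rcases min_lt_iff.1 hmin with h | h
        · rw [div_lt_iff₀ hx] at h
          linarith
        · linarith [hu.1]
      have hu1 : u ≤ 1 := by nlinarith
      have hxu := ha u ⟨hu.1.le, hu1⟩
      rw [hsupp (x + u * a) fun h ↦ by linarith [h.2],
        hsupp x fun h ↦ by nlinarith [h.2, mul_pos hx hu.1]]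
      simp
    · rw [abs_mul, abs_of_nonneg (by linarith [hu.2] : 0 ≤ 1 - u), mul_comm]
      refine mul_le_mul_of_nonneg_right ?_ (by linarith [hu.2])
      linarith [abs_sub (deriv (deriv g) (x + u * a)) (deriv (deriv g) x),
        hle (x + u * a), hle x]
  refine ⟨main, fun S ↦ ?_⟩
  simp only [mul_assoc (S ^ 2 * x)]
  rw [integral_const_mul, abs_mul, abs_of_nonneg (by positivity : 0 ≤ S ^ 2 * x)]
  calc _ ≤ _ := mul_le_mul_of_nonneg_left main (by positivity)
    _ = _ := by ring
end
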